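/- Explicit annulus SLE partition function for κ = 2 (excursion-reflected case): for r > 0 and x ∈ (0,2π), the function Z(r,x) := Θ′(r,0)·H(r,x)/Θ(r,x) satisfies the null-vector equation ∂_r Z = ∂_x² Z + H(r,x)·∂_x Z + H′(r,x)·Z − 3·(ζ_r(π)/π)·Z (this is the equation ∂_r Z = (κ/2)Z″ + H Z′ + (3/κ − 1/2)H′ Z − (6/κ)(ζ_r(π)/π) Z with κ = 2). -/

import Mathlib

open Complex

/-- The theta function Θ(r,z) = (1/i)·∑_{n∈ℤ} (−1)^n e^{−r(n+1/2)²} e^{(n+1/2)iz}. -/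
noncomputable def Theta (r : ℝ) (z : ℂ) : ℂ :=
  (1 / Complex.I) * ∑' n : ℤ, (-1 : ℂ) ^ n *
    Complex.exp (-(r : ℂ) * ((n : ℂ) + 1 / 2) ^ 2) *
    Complex.exp (((n : ℂ) + 1 / 2) * Complex.I * z)

/-- The Loewner kernel H(r,z) = 2 Θ′(r,z)/Θ(r,z). -/
noncomputable def Hker (r : ℝ) (z : ℂ) : ℂ := 2 * deriv (Theta r) z / Theta r z

/-- The lattice L_r = 2πℤ + 2irℤ. -/
def ThetaLattice (r : ℝ) : Set ℂ :=
  {z | ∃ m n : ℤ, z = 2 * (Real.pi : ℂ) * m + 2 * Complex.I * r * n}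

/-- Lattice point 2πm + 2irn. -/
noncomputable def latPt (r : ℝ) (p : ℤ × ℤ) : ℂ :=
  2 * (Real.pi : ℂ) * p.1 + 2 * Complex.I * (r : ℂ) * p.2

/-- The Weierstrass zeta function with periods (2π, 2ir). -/
noncomputable def wzeta (r : ℝ) (z : ℂ) : ℂ :=
  1 / z + ∑' p : ℤ × ℤ, if p = 0 then 0 else
    (1 / (z - latPt r p) + 1 / latPt r p + z / latPt r p ^ 2)

/-- The explicit annulus SLE partition function for κ = 2 (ER case):
Z(r,x) = Θ′(r,0)·H(r,x)/Θ(r,x). -/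
noncomputable def Ztwo (r x : ℝ) : ℝ :=
  (deriv (Theta r) 0).re * (Hker r (x : ℂ)).re / (Theta r (x : ℂ)).re


/-- Half-integer frequency `n + 1/2`. -/
noncomputable def hfreq (n : ℤ) : ℝ := (n : ℝ) + 1 / 2

/-- General term of the `k`-th derivative series of theta. -/
noncomputable def sTerm (k : ℕ) (r : ℝ) (z : ℂ) (n : ℤ) : ℂ :=
  (-1 : ℂ) ^ n * (Complex.I * (hfreq n : ℂ)) ^ k *
    Complex.exp (-(r : ℂ) * (hfreq n : ℂ) ^ 2 + (hfreq n : ℂ) * Complex.I * z)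

/-- `k`-th derivative series of theta. -/
noncomputable def SS (k : ℕ) (r : ℝ) (z : ℂ) : ℂ := (1 / Complex.I) * ∑' n : ℤ, sTerm k r z n

lemma Theta_eq_SS (r : ℝ) (z : ℂ) : Theta r z = SS 0 r z := by
  unfold Theta SS sTerm hfreq
  congr 1
  apply tsum_congr
  intro n
  rw [mul_assoc, ← Complex.exp_add]
  push_cast
  simp

/-- summable majorant -/
noncomputable def majo (k : ℕ) (ρ B : ℝ) (n : ℤ) : ℝ :=
  |hfreq n| ^ k * Real.exp (-ρ * (hfreq n) ^ 2 + |hfreq n| * B)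

lemma summable_exp_neg_abs_int : Summable (fun n : ℤ => Real.exp (-|(n : ℝ)|)) := by
  have h : Summable (fun n : ℕ => Real.exp (-(n : ℝ))) := by
    have := Real.summable_exp_nat_mul_iff.mpr (show (-1 : ℝ) < 0 by norm_num)
    simpa using this
  apply Summable.of_nat_of_neg <;> simpa using h

lemma majo_summable (k : ℕ) {ρ : ℝ} (hρ : 0 < ρ) (B : ℝ) : Summable (majo k ρ B) := by
  apply Summable.of_nonneg_of_le (f := fun n : ℤ =>
    (k.factorial * Real.exp ((B + 2) ^ 2 / (4 * ρ) + 1 / 2)) * Real.exp (-|(n : ℝ)|))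
  · intro n; unfold majo; positivity
  · intro n
    unfold majo
    set a := |hfreq n| with ha
    have ha0 : 0 ≤ a := abs_nonneg _
    have h1 : a ^ k ≤ k.factorial * Real.exp a := by
      have := Real.pow_div_factorial_le_exp a ha0 k
      rw [div_le_iff₀ (by positivity)] at this
      linarith
    have hsq : hfreq n ^ 2 = a ^ 2 := by rw [ha, sq_abs]
    have hn : |(n : ℝ)| ≤ a + 1 / 2 := by
      rw [ha]
      have : (n : ℝ) = hfreq n - 1 / 2 := by unfold hfreq; ring
      rw [this]
      refine (abs_sub _ _).trans ?_
      norm_num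
    calc a ^ k * Real.exp (-ρ * hfreq n ^ 2 + a * B)
        ≤ (k.factorial * Real.exp a) * Real.exp (-ρ * hfreq n ^ 2 + a * B) := by gcongr
      _ = k.factorial * Real.exp (a + (-ρ * a ^ 2 + a * B)) := by
          rw [mul_assoc, ← Real.exp_add, hsq]
      _ ≤ k.factorial * Real.exp (((B + 2) ^ 2 / (4 * ρ) + 1 / 2) + -|(n : ℝ)|) := by
          refine mul_le_mul_of_nonneg_left (Real.exp_le_exp.mpr ?_) (by positivity)
          have : (B + 2) * a - ρ * a ^ 2 ≤ (B + 2) ^ 2 / (4 * ρ) := by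
            rw [le_div_iff₀ (by positivity)]
            nlinarith [sq_nonneg ((B + 2) - 2 * ρ * a)]
          linarith
      _ = _ := by rw [Real.exp_add _ (-|(n : ℝ)|)]; ring
  · exact summable_exp_neg_abs_int.mul_left _

lemma norm_sTerm_le (k : ℕ) {ρ r : ℝ} (h : ρ ≤ r) {B : ℝ} {z : ℂ} (hz : |z.im| ≤ B) (n : ℤ) :
    ‖sTerm k r z n‖ ≤ majo k ρ B n := by
  unfold sTerm majo
  rw [norm_mul, norm_mul, norm_pow, norm_mul, Complex.norm_exp]
  have h1 : ‖(-1 : ℂ) ^ n‖ = 1 := by simp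
  rw [h1]
  simp only [Complex.norm_I, one_mul, Complex.norm_real, Real.norm_eq_abs]
  gcongr
  have : (-(r : ℂ) * (hfreq n : ℂ) ^ 2 + (hfreq n : ℂ) * Complex.I * z).re
      = -r * hfreq n ^ 2 - hfreq n * z.im := by
    rw [← Complex.ofReal_pow]
    simp only [Complex.add_re, Complex.mul_re, Complex.mul_im, Complex.neg_re, Complex.neg_im,
      Complex.ofReal_re, Complex.ofReal_im, Complex.I_re, Complex.I_im]
    ring
  rw [this]
  have h2 : -(hfreq n * z.im) ≤ |hfreq n| * B := by
    calc -(hfreq n * z.im) ≤ |hfreq n * z.im| := neg_le_abs _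
      _ = |hfreq n| * |z.im| := abs_mul _ _
      _ ≤ _ := by gcongr
  nlinarith [mul_le_mul_of_nonneg_right h (sq_nonneg (hfreq n))]

lemma sTerm_summable (k : ℕ) {r : ℝ} (hr : 0 < r) (z : ℂ) : Summable (sTerm k r z) :=
  Summable.of_norm_bounded (majo_summable k hr |z.im|) (fun n => norm_sTerm_le k le_rfl le_rfl n)

lemma SS_hasDerivAt_z (k : ℕ) {r : ℝ} (hr : 0 < r) (z : ℂ) :
    HasDerivAt (SS k r) (SS (k + 1) r z) z := by
  unfold SS
  apply HasDerivAt.const_mul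
  set B := |z.im| + 1 with hB
  have ho : IsOpen {w : ℂ | |w.im| < B} :=
    isOpen_lt (by fun_prop) continuous_const
  have hc : IsPreconnected {w : ℂ | |w.im| < B} := by
    have : {w : ℂ | |w.im| < B} = Complex.imCLM ⁻¹' (Metric.ball 0 B) := by
      ext w; simp
    rw [this]
    have hcv : Convex ℝ (Complex.imCLM ⁻¹' (Metric.ball 0 B)) :=
      (convex_ball 0 B).linear_preimage Complex.imCLM.toLinearMap
    exact hcv.isPreconnected
  have hz : z ∈ {w : ℂ | |w.im| < B} := by simp [hB]
  refine hasDerivAt_tsum_of_isPreconnected (g := fun n w => sTerm k r w n)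
    (g' := fun n w => sTerm (k + 1) r w n) (majo_summable (k + 1) hr B) ho hc ?_ ?_ hz
    (sTerm_summable k hr z) hz
  · intro n w hw
    unfold sTerm
    have h1 : HasDerivAt (fun w : ℂ => -(r : ℂ) * (hfreq n : ℂ) ^ 2 + (hfreq n : ℂ) * Complex.I * w)
        ((hfreq n : ℂ) * Complex.I) w := by
      simpa using ((hasDerivAt_id w).const_mul ((hfreq n : ℂ) * Complex.I)).const_add
        (-(r : ℂ) * (hfreq n : ℂ) ^ 2)
    refine (h1.cexp.const_mul ((-1 : ℂ) ^ n * (Complex.I * (hfreq n : ℂ)) ^ k)).congr_deriv ?_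
    ring
  · intro n w hw
    exact norm_sTerm_le (k + 1) le_rfl (le_of_lt hw) n

lemma SS_hasDerivAt_r (k : ℕ) {r : ℝ} (hr : 0 < r) (z : ℂ) :
    HasDerivAt (fun s : ℝ => SS k s z) (SS (k + 2) r z) r := by
  unfold SS
  apply HasDerivAt.const_mul
  have hz : r ∈ Set.Ioi (r / 2) := by simp [hr]
  refine hasDerivAt_tsum_of_isPreconnected (g := fun n s => sTerm k s z n)
    (g' := fun n s => sTerm (k + 2) s z n) (majo_summable (k + 2) (half_pos hr) |z.im|)
    isOpen_Ioi isPreconnected_Ioi ?_ ?_ hz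
    (sTerm_summable k hr z) hz
  · intro n s hs
    unfold sTerm
    have h0 : HasDerivAt (fun s : ℝ => (s : ℂ)) 1 s := Complex.ofRealCLM.hasDerivAt
    have h1 : HasDerivAt (fun s : ℝ => -(s : ℂ) * (hfreq n : ℂ) ^ 2 + (hfreq n : ℂ) * Complex.I * z)
        (-(hfreq n : ℂ) ^ 2) s := by
      simpa using (h0.neg.mul_const ((hfreq n : ℂ) ^ 2)).add_const ((hfreq n : ℂ) * Complex.I * z)
    refine (h1.cexp.const_mul ((-1 : ℂ) ^ n * (Complex.I * (hfreq n : ℂ)) ^ k)).congr_deriv ?_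
    rw [pow_add, mul_pow Complex.I _ 2, Complex.I_sq]
    ring
  · intro n s hs
    exact norm_sTerm_le (k + 2) (le_of_lt hs) le_rfl n

lemma SS_conj (k : ℕ) (r x : ℝ) : (starRingEnd ℂ) (SS k r x) = SS k r x := by
  unfold SS
  rw [map_mul, Complex.conj_tsum]
  have hI : (starRingEnd ℂ) (1 / Complex.I) = -(1 / Complex.I) := by simp
  rw [hI, neg_mul, ← mul_neg, ← tsum_neg]
  congr 1
  rw [← (Equiv.subLeft (-1 : ℤ)).tsum_eq (fun n => sTerm k r x n)]
  apply tsum_congr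
  intro n
  have hf : hfreq (Equiv.subLeft (-1 : ℤ) n) = -hfreq n := by
    simp [hfreq]; ring
  unfold sTerm
  rw [hf]
  have h1 : (-1 : ℂ) ^ (Equiv.subLeft (-1 : ℤ) n) = - (-1 : ℂ) ^ n := by
    simp only [Equiv.subLeft_apply]
    rw [zpow_sub₀ (by norm_num)]
    rcases Int.even_or_odd n with h | h
    · simp [h.neg_one_zpow]
    · simp [h.neg_one_zpow]
  rw [h1]
  simp only [map_mul, map_pow, map_zpow₀, map_neg, map_one, Complex.conj_I, Complex.conj_ofReal,
    ← Complex.exp_conj, map_add]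
  push_cast
  ring_nf

/-- The real version. -/
noncomputable def ss (k : ℕ) (r x : ℝ) : ℝ := (SS k r x).re

lemma ss_ofReal (k : ℕ) (r x : ℝ) : ((ss k r x : ℝ) : ℂ) = SS k r x :=
  Complex.conj_eq_iff_re.mp (SS_conj k r x)

lemma ss_hasDerivAt_x (k : ℕ) {r : ℝ} (hr : 0 < r) (x : ℝ) :
    HasDerivAt (fun y => ss k r y) (ss (k + 1) r x) x :=
  (SS_hasDerivAt_z k hr (x : ℂ)).real_of_complex

lemma ss_hasDerivAt_r (k : ℕ) {r : ℝ} (hr : 0 < r) (x : ℝ) :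
    HasDerivAt (fun s => ss k s x) (ss (k + 2) r x) r :=
  Complex.reCLM.hasFDerivAt.comp_hasDerivAt r (SS_hasDerivAt_r k hr (x : ℂ))

lemma deriv_Theta {r : ℝ} (hr : 0 < r) : deriv (Theta r) = SS 1 r := by
  have : Theta r = SS 0 r := funext (Theta_eq_SS r)
  rw [this]
  funext z
  exact (SS_hasDerivAt_z 0 hr z).deriv

/-- The modular parameter `τ = i r / π`. -/
noncomputable def tauR (r : ℝ) (hr : 0 < r) : UpperHalfPlane :=
  ⟨Complex.I * ((r / Real.pi : ℝ) : ℂ), by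
    simp only [Complex.mul_im, Complex.I_re, Complex.I_im, Complex.ofReal_re, Complex.ofReal_im]
    have := div_pos hr Real.pi_pos
    simpa using this⟩

lemma tauR_coe (r : ℝ) (hr : 0 < r) : ((tauR r hr : UpperHalfPlane) : ℂ)
    = Complex.I * ((r / Real.pi : ℝ) : ℂ) := rfl

/-- Normalised summand. -/
noncomputable def FF (u : ℂ) : ℂ := 1 / (1 / 2 - u) + 1 / u + 1 / 2 * (1 / u ^ 2)

lemma half_ne (τ : UpperHalfPlane) (n m : ℤ) : (1 / 2 : ℂ) - ((n : ℂ) * τ + m) ≠ 0 := by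
  intro h
  have h2 : ((2 * n : ℤ) : ℂ) * τ + ((2 * m - 1 : ℤ) : ℂ) = 0 := by
    push_cast
    linear_combination (-2) * h
  have him := congrArg Complex.im h2
  simp [Complex.mul_im] at him
  rcases him with h | h
  · subst h
    rw [mul_zero, Int.cast_zero, zero_mul, zero_add] at h2
    have h3 : (2 * m - 1 : ℤ) = 0 := by exact_mod_cast h2
    omega
  · exact absurd h τ.im_pos.ne'

lemma FF_summable_vec (τ : UpperHalfPlane) :
    Summable (fun v : Fin 2 → ℤ => FF ((v 0 : ℂ) * τ + v 1)) := by
  have hO : (fun v : Fin 2 → ℤ => ((v 0 : ℂ) * τ + v 1)⁻¹) =O[Filter.cofinite]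
      (fun v => ‖v‖⁻¹) := by
    simpa using EisensteinSeries.isBigO_linear_add_const_vec τ 0 0
  have hinj : Function.Injective (fun v : Fin 2 → ℤ => ![2 * v 0, 2 * v 1 - 1]) := by
    intro v w h
    have h0 := congrFun h 0
    have h1 := congrFun h 1
    simp at h0 h1
    ext i
    fin_cases i
    · simpa using h0
    · simpa using h1
  have hO2 : (fun v : Fin 2 → ℤ => ((1 / 2 : ℂ) - ((v 0 : ℂ) * τ + v 1))⁻¹) =O[Filter.cofinite]
      (fun v => ‖v‖⁻¹) := by
    have h1 := hO.comp_tendsto hinj.tendsto_cofinite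
    have h2 : ((fun v : Fin 2 → ℤ => ‖v‖⁻¹) ∘ (fun v : Fin 2 → ℤ => ![2 * v 0, 2 * v 1 - 1]))
        =O[Filter.cofinite] (fun v => ‖v‖⁻¹) := by
      apply Asymptotics.IsBigO.of_bound 1
      have hne : ∀ᶠ v : Fin 2 → ℤ in Filter.cofinite, v ≠ 0 := by
        simp [Filter.eventually_cofinite]
      filter_upwards [hne] with v hv
      have hvpos : 0 < ‖v‖ := norm_pos_iff.mpr hv
      simp only [Function.comp, norm_inv, norm_norm, one_mul]
      apply inv_anti₀ hvpos
      rw [pi_norm_le_iff_of_nonneg (norm_nonneg _)]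
      intro i
      fin_cases i
      · refine le_trans ?_ (norm_le_pi_norm _ 0)
        simp only [Matrix.cons_val_zero, Int.norm_eq_abs, Fin.zero_eta]
        norm_cast
        rw [abs_mul]; have := abs_nonneg (v 0); norm_num; omega
      · refine le_trans ?_ (norm_le_pi_norm _ 1)
        simp only [Matrix.cons_val_one, Int.norm_eq_abs, Fin.mk_one, Matrix.cons_val_zero]
        norm_cast
        rcases abs_cases (v 1) with h | h <;> rcases abs_cases (2 * v 1 - 1) with h' | h' <;> omega
    have h3 := (h1.trans h2).const_mul_left (-2)
    refine h3.congr_left ?_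
    intro v
    simp only [Function.comp, Matrix.cons_val_zero, Matrix.cons_val_one]
    push_cast
    have := half_ne τ (v 0) (v 1)
    have h4 : 2 * (v 0 : ℂ) * τ + (2 * v 1 - 1) = (-2) * ((1 / 2 : ℂ) - ((v 0 : ℂ) * τ + v 1)) := by
      ring
    rw [h4, mul_inv]
    ring
  have H := ((hO2.mul hO).mul hO).const_mul_left (1 / 4)
  apply EisensteinSeries.summable_of_isBigO_rpow_norm (a := 3) (by norm_num)
  have hne : ∀ᶠ v : Fin 2 → ℤ in Filter.cofinite, v ≠ 0 := by
    simp [Filter.eventually_cofinite]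
  refine H.congr' ?_ ?_
  · filter_upwards [hne] with v hv
    have h0 : (v 0 : ℂ) * τ + v 1 ≠ 0 := by
      have := UpperHalfPlane.linear_ne_zero (cd := fun i => (v i : ℝ)) τ (by
        intro h; apply hv; ext i; have := congrFun h i; simpa using this)
      simpa using this
    have h1 := half_ne τ (v 0) (v 1)
    unfold FF
    generalize (v 0 : ℂ) * τ + v 1 = u at *
    have h2 : 1 - 2 * u ≠ 0 := by
      intro h; apply h1; linear_combination h / 2
    field_simp
    ring
  · refine Filter.Eventually.of_forall fun v => ?_
    have h3 : ‖v‖ ^ (3 : ℝ) = ‖v‖ ^ 3 := by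
      rw [← Real.rpow_natCast]; norm_num
    simp only [h3]
    rw [← mul_inv, ← mul_inv]
    ring_nf

lemma FF_summable (τ : UpperHalfPlane) :
    Summable (fun p : ℤ × ℤ => FF ((p.1 : ℂ) * τ + p.2)) := by
  have := (finTwoArrowEquiv ℤ).symm.summable_iff.mpr (FF_summable_vec τ)
  simpa [Function.comp_def, finTwoArrowEquiv] using this

/-- Odd part of the row sums. -/
noncomputable def AA (u : ℂ) : ℂ := 1 / (1 / 2 - u) + 1 / u

lemma inv_sq_summable (τ : UpperHalfPlane) (n : ℤ) :
    Summable (fun m : ℤ => 1 / ((n : ℂ) * τ + m) ^ 2) := by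
  have := EisensteinSeries.e2Summand_summable n τ
  simpa [EisensteinSeries.eisSummand] using! this

lemma e2Summand_eq (τ : UpperHalfPlane) (n : ℤ) :
    EisensteinSeries.e2Summand n τ = ∑' m : ℤ, 1 / ((n : ℂ) * τ + m) ^ 2 := by
  unfold EisensteinSeries.e2Summand
  apply tsum_congr
  intro m
  simp [EisensteinSeries.eisSummand]

lemma AA_summable (τ : UpperHalfPlane) (n : ℤ) :
    Summable (fun m : ℤ => AA ((n : ℂ) * τ + m)) := by
  have h1 := (FF_summable τ).prod_factor n
  have h2 := h1.sub ((inv_sq_summable τ n).mul_left (1 / 2))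
  refine h2.congr ?_
  intro m
  simp only [FF, AA]
  ring

lemma tendsto_inv_add_nat (c : ℂ) : Filter.Tendsto (fun N : ℕ => 1 / (c + N)) Filter.atTop
    (nhds 0) := by
  simp_rw [one_div]
  refine Filter.tendsto_inv₀_cobounded.comp ?_
  rw [← tendsto_norm_atTop_iff_cobounded]
  have h : Filter.Tendsto (fun N : ℕ => (N : ℝ) - ‖c‖) Filter.atTop Filter.atTop :=
    Filter.tendsto_atTop_add_const_right _ _ tendsto_natCast_atTop_atTop
  refine Filter.tendsto_atTop_mono (fun N => ?_) h
  have := norm_sub_le (c + N) c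
  simp at this
  linarith

lemma tendsto_inv_sub_nat (c : ℂ) : Filter.Tendsto (fun N : ℕ => 1 / (c - N)) Filter.atTop
    (nhds 0) := by
  have := (tendsto_inv_add_nat (-c)).neg
  simp only [neg_zero] at this
  refine this.congr ?_
  intro N
  rw [← div_neg]; ring_nf

lemma AA_odd (τ : UpperHalfPlane) (n : ℤ) :
    (∑' m : ℤ, AA (((-n : ℤ) : ℂ) * τ + m)) = - ∑' m : ℤ, AA ((n : ℂ) * τ + m) := by
  rw [eq_neg_iff_add_eq_zero, ← (Equiv.neg ℤ).tsum_eq]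
  have hs := (Equiv.neg ℤ).summable_iff.mpr (AA_summable τ (-n))
  have hs' : Summable (fun m : ℤ => AA (((-n : ℤ) : ℂ) * τ + (((Equiv.neg ℤ) m : ℤ) : ℂ))) := hs
  rw [← hs'.tsum_add (AA_summable τ n)]
  have hs2 := hs'.add (AA_summable τ n)
  have hh := SummationFilter.hasSum_symmetricIco_int_iff.mp
    (hs2.hasSum.mono_left (SummationFilter.LeAtTop.le_atTop))
  refine tendsto_nhds_unique hh ?_
  have ht := (tendsto_inv_add_nat ((n : ℂ) * τ - 1 / 2)).sub
    (tendsto_inv_sub_nat ((n : ℂ) * τ - 1 / 2))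
  rw [sub_zero] at ht
  refine ht.congr ?_
  intro N
  have := Finset.sum_Ico_int_sub N (fun m : ℤ => 1 / ((n : ℂ) * τ - 1 / 2 + m))
  have h2 : ∀ m : ℤ, AA (((-n : ℤ) : ℂ) * τ + (((Equiv.neg ℤ) m : ℤ) : ℂ)) + AA ((n : ℂ) * τ + m)
      = -(1 / ((n : ℂ) * τ - 1 / 2 + m) - 1 / ((n : ℂ) * τ - 1 / 2 + ((m + 1 : ℤ) : ℂ))) := by
    intro m
    simp only [AA, Equiv.neg_apply, Int.cast_neg, Int.cast_add, Int.cast_one]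
    rw [show -(n : ℂ) * τ + -(m : ℂ) = -((n : ℂ) * τ + m) by ring,
      show (n : ℂ) * τ - 1 / 2 + m = -(1 / 2 - ((n : ℂ) * τ + m)) by ring,
      show (n : ℂ) * τ - 1 / 2 + (m + 1) = 1 / 2 - -((n : ℂ) * τ + m) by ring, div_neg, div_neg]
    ring
  simp_rw [h2]
  rw [Finset.sum_neg_distrib, this]
  push_cast
  rw [← sub_eq_add_neg]
  ring

lemma FF_tsum (τ : UpperHalfPlane) :
    ∑' p : ℤ × ℤ, FF ((p.1 : ℂ) * τ + p.2) = 1 / 2 * EisensteinSeries.G2 τ := by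
  rw [(FF_summable τ).tsum_prod]
  have hS := (FF_summable τ).prod
  have hrow : ∀ n : ℤ, ∑' m : ℤ, FF ((n : ℂ) * τ + m) =
      (∑' m : ℤ, AA ((n : ℂ) * τ + m)) + 1 / 2 * EisensteinSeries.e2Summand n τ := by
    intro n
    rw [e2Summand_eq, ← tsum_mul_left, ← (AA_summable τ n).tsum_add
      ((inv_sq_summable τ n).mul_left (1 / 2))]
    rfl
  have h1 := SummationFilter.hasSum_symmetricIcc_iff.mp
    (hS.hasSum.mono_left (SummationFilter.LeAtTop.le_atTop (L := SummationFilter.symmetricIcc ℤ)))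
  have h2 := SummationFilter.hasSum_symmetricIcc_iff.mp
    ((EisensteinSeries.summable_e2Summand_symmetricIcc τ).hasSum.mul_left (1 / 2))
  refine tendsto_nhds_unique h1 (h2.congr ?_)
  intro N
  simp_rw [hrow]
  rw [Finset.sum_add_distrib]
  have h0 : ∑ n ∈ Finset.Icc (-(N : ℤ)) N, (∑' m : ℤ, AA ((n : ℂ) * τ + m)) = 0 := by
    set f := fun n : ℤ => ∑' m : ℤ, AA ((n : ℂ) * τ + m) with hf
    have hodd : ∀ n, f (-n) = - f n := AA_odd τ
    have h3 : ∑ n ∈ Finset.Icc (-(N : ℤ)) N, f n = ∑ n ∈ Finset.Icc (-(N : ℤ)) N, f (-n) := by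
      apply Finset.sum_nbij' (fun n => -n) (fun n => -n)
      · intro a ha; simp only [Finset.mem_Icc] at *; omega
      · intro a ha; simp only [Finset.mem_Icc] at *; omega
      · intro a _; simp
      · intro a _; simp
      · intro a _; simp
    have h4 : ∑ n ∈ Finset.Icc (-(N : ℤ)) N, f n = - ∑ n ∈ Finset.Icc (-(N : ℤ)) N, f n := by
      rw [← Finset.sum_neg_distrib]
      simp_rw [← hodd]
      exact h3
    exact self_eq_neg.mp h4
  rw [h0, zero_add]

lemma wzeta_pi (r : ℝ) (hr : 0 < r) :
    wzeta r (Real.pi : ℂ) = Real.pi / 12 * EisensteinSeries.E2 (tauR r hr) := by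
  have hpi : (Real.pi : ℂ) ≠ 0 := by exact_mod_cast Real.pi_ne_zero
  set τ := tauR r hr with hτ
  have hlat : ∀ p : ℤ × ℤ, latPt r p = 2 * Real.pi * ((p.2 : ℂ) * τ + p.1) := by
    intro p
    rw [hτ, tauR_coe]
    unfold latPt
    push_cast
    field_simp
    ring
  set f : ℤ × ℤ → ℂ := fun p => 1 / ((Real.pi : ℂ) - latPt r p) + 1 / latPt r p
    + (Real.pi : ℂ) / latPt r p ^ 2 with hf
  have hfF : ∀ p, f p = 1 / (2 * Real.pi) * FF ((p.2 : ℂ) * τ + p.1) := by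
    intro p
    simp only [hf, hlat, FF]
    generalize (p.2 : ℂ) * τ + p.1 = u
    rw [show (Real.pi : ℂ) - 2 * Real.pi * u = 2 * Real.pi * (1 / 2 - u) by ring]
    simp only [mul_inv, mul_pow, div_eq_mul_inv]
    have : (Real.pi : ℂ) * ((2⁻¹ : ℂ) ^ 2 * (Real.pi : ℂ)⁻¹ ^ 2) =
      (2⁻¹ : ℂ) * 2⁻¹ * (Real.pi : ℂ)⁻¹ := by field_simp
    rw [← inv_pow, ← inv_pow, ← inv_pow]
    linear_combination (u⁻¹ ^ 2) * this
  have hsum0 : Summable (fun p : ℤ × ℤ => FF ((p.2 : ℂ) * τ + p.1)) :=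
    (Equiv.prodComm ℤ ℤ).summable_iff.mpr (FF_summable τ)
  have hsum : Summable f := by
    rw [funext hfF]
    exact hsum0.mul_left _
  have h1 : wzeta r (Real.pi : ℂ) = ∑' p, f p := by
    rw [hsum.tsum_eq_add_tsum_ite 0]
    unfold wzeta
    have : f 0 = 1 / (Real.pi : ℂ) := by
      simp [hf, latPt]
    rw [this]
  rw [h1, tsum_congr hfF, tsum_mul_left]
  have h2 : ∑' p : ℤ × ℤ, FF ((p.2 : ℂ) * τ + p.1) = ∑' p : ℤ × ℤ, FF ((p.1 : ℂ) * τ + p.2) :=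
    (Equiv.prodComm ℤ ℤ).tsum_eq (fun p : ℤ × ℤ => FF ((p.1 : ℂ) * τ + p.2))
  rw [h2, FF_tsum]
  simp only [EisensteinSeries.E2, Pi.smul_apply, smul_eq_mul, riemannZeta_two]
  field_simp
  ring

/-- Gaussian binomial coefficients. -/
noncomputable def gb (Q : ℝ) : ℕ → ℕ → ℝ
  | _, 0 => 1
  | 0, _ + 1 => 0
  | M + 1, j + 1 => gb Q M j + Q ^ (j + 1) * gb Q M (j + 1)

/-- Finite q-Pochhammer. -/
noncomputable def pq (Q : ℝ) (N : ℕ) : ℝ := ∏ k ∈ Finset.range N, (1 - Q ^ (k + 1))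

lemma gb_zero_right (Q : ℝ) (M : ℕ) : gb Q M 0 = 1 := by cases M <;> simp [gb]

lemma gb_eq_zero (Q : ℝ) (M : ℕ) : ∀ j, M < j → gb Q M j = 0 := by
  induction M with
  | zero => intro j hj; cases j with
    | zero => omega
    | succ j => simp [gb]
  | succ M ih => intro j hj; cases j with
    | zero => omega
    | succ j => rw [gb, ih j (by omega), ih (j + 1) (by omega)]; simp

lemma pq_succ (Q : ℝ) (N : ℕ) : pq Q (N + 1) = pq Q N * (1 - Q ^ (N + 1)) := by
  unfold pq; rw [Finset.prod_range_succ]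

lemma gb_closed (Q : ℝ) (M : ℕ) : ∀ a b : ℕ, a + b = M → gb Q M a * (pq Q a * pq Q b) = pq Q M := by
  induction M with
  | zero =>
    intro a b h
    obtain ⟨rfl, rfl⟩ : a = 0 ∧ b = 0 := by omega
    simp [gb, pq]
  | succ M ih =>
    intro a b h
    cases a with
    | zero =>
      obtain rfl : b = M + 1 := by omega
      simp [gb, pq]
    | succ a =>
      cases b with
      | zero =>
        obtain rfl : a = M := by omega
        have := ih a 0 (by omega)
        have h0 : pq Q 0 = 1 := by simp [pq]
        rw [gb, gb_eq_zero Q a (a + 1) (by omega), pq_succ, h0]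
        rw [h0] at this
        linear_combination (1 - Q ^ (a + 1)) * this
      | succ b =>
        have h1 := ih a (b + 1) (by omega)
        have h2 := ih (a + 1) b (by omega)
        rw [gb, pq_succ Q M]
        have hM : M = a + b + 1 := by omega
        have e1 := pq_succ Q a
        have e2 := pq_succ Q b
        have e3 : Q ^ (M + 1) = Q ^ (a + 1) * Q ^ (b + 1) := by rw [hM, ← pow_add]; ring_nf
        rw [e3]
        rw [e2] at h1 ⊢
        rw [e1] at h2 ⊢
        linear_combination (1 - Q ^ (a + 1)) * h1 + Q ^ (a + 1) * (1 - Q ^ (b + 1)) * h2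

lemma q_binomial (q : ℝ) (M : ℕ) : ∀ x : ℂ,
    ∏ k ∈ Finset.range M, (1 + x * ((q : ℂ) ^ 2) ^ k) =
    ∑ j ∈ Finset.range (M + 1), (q : ℂ) ^ (j * (j - 1)) * (gb (q ^ 2) M j : ℂ) * x ^ j := by
  induction M with
  | zero => intro x; simp [gb]
  | succ M ih =>
    intro x
    rw [Finset.prod_range_succ']
    have h1 : ∏ k ∈ Finset.range M, (1 + x * ((q : ℂ) ^ 2) ^ (k + 1)) =
        ∏ k ∈ Finset.range M, (1 + (x * (q : ℂ) ^ 2) * ((q : ℂ) ^ 2) ^ k) := by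
      apply Finset.prod_congr rfl; intro k _; ring
    rw [h1, ih, pow_zero, mul_one, mul_add, mul_one]
    set c : ℕ → ℂ := fun j => (q : ℂ) ^ (j * (j - 1)) * (gb (q ^ 2) M j : ℂ) * (x * (q : ℂ) ^ 2) ^ j
      with hc
    have h2 : ∑ j ∈ Finset.range (M + 1), c j = c 0 + ∑ j ∈ Finset.range (M + 1), c (j + 1) := by
      rw [Finset.sum_range_succ' c M, Finset.sum_range_succ (fun j => c (j + 1)) M]
      have : c (M + 1) = 0 := by simp [hc, gb_eq_zero _ M (M + 1) (by omega)]
      rw [this]; ring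
    rw [Finset.sum_range_succ' _ (M + 1)]
    change ∑ j ∈ Finset.range (M + 1), c j + (∑ j ∈ Finset.range (M + 1), c j) * x = _
    rw [Finset.sum_mul]
    nth_rewrite 1 [h2]
    have h3 : c 0 = 1 := by simp [hc, gb_zero_right]
    have h4 : ∀ j, (q : ℂ) ^ ((j + 1) * (j + 1 - 1)) * (gb (q ^ 2) (M + 1) (j + 1) : ℂ) * x ^ (j + 1)
        = c (j + 1) + c j * x := by
      intro j
      simp only [hc, gb]
      have : (q : ℂ) ^ ((j + 1) * (j + 1 - 1)) = (q : ℂ) ^ (j * (j - 1)) * ((q : ℂ) ^ 2) ^ j := by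
        rw [← pow_mul, ← pow_add]
        congr 1
        cases j with
        | zero => simp
        | succ j => simp; ring
      push_cast
      rw [Nat.add_sub_cancel] at this
      rw [this]
      ring
    simp_rw [h4]
    rw [Finset.sum_add_distrib, h3]
    simp [gb_zero_right]
    ring

/-- The finite two sided product. -/
noncomputable def LL (q : ℝ) (w : ℂ) (N : ℕ) : ℂ :=
  (∏ k ∈ Finset.range N, (1 - ((q : ℂ) ^ 2) ^ (k + 1) * w)) *
  (∏ k ∈ Finset.range N, (1 - ((q : ℂ) ^ 2) ^ k * w⁻¹))

/-- theta coefficients -/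
noncomputable def tt (q : ℝ) (w : ℂ) (n : ℤ) : ℂ := (-1 : ℂ) ^ n * (q : ℂ) ^ (n * (n + 1)) * w ^ n

lemma LL_eq_sum {q : ℝ} (hq : q ≠ 0) {w : ℂ} (hw : w ≠ 0) (N : ℕ) :
    LL q w N = ∑ j ∈ Finset.range (2 * N + 1), (gb (q ^ 2) (2 * N) j : ℂ) * tt q w ((j : ℤ) - N) := by
  have hqc : (q : ℂ) ≠ 0 := by exact_mod_cast hq
  have hb := q_binomial q (2 * N) (-w * (q : ℂ) ^ (2 * (1 - (N : ℤ))))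
  have hD : (-w) ^ (-(N : ℤ)) * (q : ℂ) ^ ((N : ℤ) * (N - 1)) *
      ∏ k ∈ Finset.range (2 * N), (1 + (-w * (q : ℂ) ^ (2 * (1 - (N : ℤ)))) * ((q : ℂ) ^ 2) ^ k)
      = LL q w N := by
    rw [two_mul, Finset.prod_range_add, ← Finset.prod_range_reflect _ N]
    have e1 : ∏ k ∈ Finset.range N,
        (1 + (-w * (q : ℂ) ^ (2 * (1 - (N : ℤ)))) * ((q : ℂ) ^ 2) ^ (N - 1 - k))
        = (-w) ^ (N : ℤ) * (q : ℂ) ^ (-((N : ℤ) * (N - 1))) *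
          ∏ k ∈ Finset.range N, (1 - ((q : ℂ) ^ 2) ^ k * w⁻¹) := by
      have e3 : (-w) ^ (N : ℤ) * (q : ℂ) ^ (-((N : ℤ) * (N - 1))) =
          ∏ k ∈ Finset.range N, (-w * (q : ℂ) ^ (-2 * (k : ℤ))) := by
        rw [Finset.prod_mul_distrib, Finset.prod_const, Finset.card_range, zpow_natCast]
        congr 1
        clear hb
        induction N with
        | zero => simp
        | succ N ih =>
          rw [Finset.prod_range_succ, ← ih, ← zpow_add₀ hqc]
          congr 1
          push_cast
          ring
      rw [e3, ← Finset.prod_mul_distrib]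
      apply Finset.prod_congr rfl
      intro k hk
      have hk' : k < N := Finset.mem_range.mp hk
      have e4 : ((q : ℂ) ^ 2) ^ (N - 1 - k) = (q : ℂ) ^ (2 * ((N : ℤ) - 1 - k)) := by
        rw [← pow_mul, ← zpow_natCast]
        congr 1
        push_cast [Nat.cast_sub (show k ≤ N - 1 by omega), Nat.cast_sub (show 1 ≤ N by omega)]
        ring
      have e5 : ((q : ℂ) ^ 2) ^ k = (q : ℂ) ^ (2 * (k : ℤ)) := by
        rw [← pow_mul, ← zpow_natCast]
        push_cast; rfl
      rw [e4, e5, mul_assoc, ← zpow_add₀ hqc]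
      have e6 : (q : ℂ) ^ (-2 * (k : ℤ)) * (q : ℂ) ^ (2 * (k : ℤ)) = 1 := by
        rw [← zpow_add₀ hqc]; simp
      have e7 : -w * (q : ℂ) ^ (-2 * (k : ℤ)) * ((q : ℂ) ^ (2 * (k : ℤ)) * w⁻¹) = -1 := by
        calc _ = -((q : ℂ) ^ (-2 * (k : ℤ)) * (q : ℂ) ^ (2 * (k : ℤ))) * (w * w⁻¹) := by ring
          _ = -1 := by rw [e6, mul_inv_cancel₀ hw]; ring
      rw [show 2 * (1 - (N : ℤ)) + 2 * ((N : ℤ) - 1 - k) = -2 * (k : ℤ) by ring]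
      linear_combination e7
    have e2 : ∏ k ∈ Finset.range N,
        (1 + (-w * (q : ℂ) ^ (2 * (1 - (N : ℤ)))) * ((q : ℂ) ^ 2) ^ (N + k))
        = ∏ k ∈ Finset.range N, (1 - ((q : ℂ) ^ 2) ^ (k + 1) * w) := by
      apply Finset.prod_congr rfl
      intro k hk
      have e4 : ((q : ℂ) ^ 2) ^ (N + k) = (q : ℂ) ^ (2 * ((N : ℤ) + k)) := by
        rw [← pow_mul, ← zpow_natCast]
        push_cast; rfl
      have e5 : ((q : ℂ) ^ 2) ^ (k + 1) = (q : ℂ) ^ (2 * ((k : ℤ) + 1)) := by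
        rw [← pow_mul, ← zpow_natCast]
        push_cast; rfl
      rw [e4, e5, mul_assoc, ← zpow_add₀ hqc,
        show 2 * (1 - (N : ℤ)) + 2 * ((N : ℤ) + k) = 2 * ((k : ℤ) + 1) by ring]
      ring
    rw [e1, e2]
    unfold LL
    have e8 : (-w) ^ (-(N : ℤ)) * (-w) ^ (N : ℤ) = 1 := by
      rw [← zpow_add₀ (neg_ne_zero.mpr hw)]; simp
    have e9 : (q : ℂ) ^ ((N : ℤ) * (N - 1)) * (q : ℂ) ^ (-((N : ℤ) * (N - 1))) = 1 := by
      rw [← zpow_add₀ hqc]; simp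
    generalize (∏ k ∈ Finset.range N, (1 - ((q : ℂ) ^ 2) ^ k * w⁻¹)) = X
    generalize (∏ k ∈ Finset.range N, (1 - ((q : ℂ) ^ 2) ^ (k + 1) * w)) = Y
    calc _ = ((-w) ^ (-(N : ℤ)) * (-w) ^ (N : ℤ)) *
        ((q : ℂ) ^ ((N : ℤ) * (N - 1)) * (q : ℂ) ^ (-((N : ℤ) * (N - 1)))) * (Y * X) := by ring
      _ = Y * X := by rw [e8, e9]; ring
  rw [← hD, hb, Finset.mul_sum]
  apply Finset.sum_congr rfl
  intro j hj
  have hneg : (-1 : ℂ) ^ ((j : ℤ) - N) * w ^ ((j : ℤ) - N) = (-w) ^ ((j : ℤ) - N) := by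
    rw [← mul_zpow]; simp
  have f1 : (q : ℂ) ^ (j * (j - 1)) = (q : ℂ) ^ ((j : ℤ) * (j - 1)) := by
    rw [← zpow_natCast]
    cases j with
    | zero => simp
    | succ j => push_cast; simp
  have f2 : (-w * (q : ℂ) ^ (2 * (1 - (N : ℤ)))) ^ j =
      (-w) ^ (j : ℤ) * (q : ℂ) ^ (2 * (1 - (N : ℤ)) * j) := by
    rw [mul_pow, zpow_natCast, zpow_mul (q : ℂ) (2 * (1 - (N : ℤ))) j, zpow_natCast]
  have f3 : tt q w ((j : ℤ) - N) = (-w) ^ (-(N : ℤ)) * (-w) ^ (j : ℤ) *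
      ((q : ℂ) ^ ((N : ℤ) * (N - 1)) * (q : ℂ) ^ ((j : ℤ) * (j - 1)) *
        (q : ℂ) ^ (2 * (1 - (N : ℤ)) * j)) := by
    rw [← zpow_add₀ hqc, ← zpow_add₀ hqc, ← zpow_add₀ (neg_ne_zero.mpr hw)]
    unfold tt
    rw [mul_right_comm, hneg]
    congr 2 <;> ring
  rw [f3, f1, f2]
  ring

/-- The infinite product `∏ (1 - Q^(k+1) w)`. -/
noncomputable def AP (Q : ℂ) (w : ℂ) : ℂ := ∏' k : ℕ, (1 - Q ^ (k + 1) * w)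

lemma summable_pow_mul {Q : ℂ} (hQ : ‖Q‖ < 1) (w : ℂ) :
    Summable (fun k : ℕ => ‖-(Q ^ (k + 1) * w)‖) := by
  simp only [norm_neg, norm_mul, norm_pow]
  exact ((summable_nat_add_iff 1).mpr
    (summable_geometric_of_lt_one (norm_nonneg _) hQ)).mul_right _

lemma AP_multipliable {Q : ℂ} (hQ : ‖Q‖ < 1) (w : ℂ) :
    Multipliable (fun k : ℕ => 1 - Q ^ (k + 1) * w) := by
  simp_rw [sub_eq_add_neg]
  exact multipliable_one_add_of_summable (summable_pow_mul hQ w)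

lemma AP_ne_zero {Q : ℂ} (hQ : ‖Q‖ < 1) {w : ℂ} (hw : ‖w‖ ≤ 1) : AP Q w ≠ 0 := by
  unfold AP
  simp_rw [sub_eq_add_neg]
  apply tprod_one_add_ne_zero_of_summable
  · intro k h
    have h1 : Q ^ (k + 1) * w = 1 := by linear_combination -h
    have h2 : ‖Q ^ (k + 1) * w‖ < 1 := by
      rw [norm_mul, norm_pow]
      calc ‖Q‖ ^ (k + 1) * ‖w‖ ≤ ‖Q‖ ^ (k + 1) * 1 := by gcongr
        _ < 1 := by rw [mul_one]; exact pow_lt_one₀ (norm_nonneg _) hQ (by omega)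
    rw [h1] at h2
    simp at h2
  · exact summable_pow_mul hQ w

lemma AP_differentiable {Q : ℂ} (hQ : ‖Q‖ < 1) : Differentiable ℂ (AP Q) := by
  have H : MultipliableLocallyUniformlyOn (fun (k : ℕ) (w : ℂ) => 1 - Q ^ (k + 1) * w)
      Set.univ := by
    use AP Q
    unfold AP
    simp_rw [sub_eq_add_neg]
    apply hasProdLocallyUniformlyOn_of_forall_compact isOpen_univ
    intro K hK hcK
    obtain ⟨C, hC⟩ := hcK.isBounded.exists_norm_le
    refine (((summable_nat_add_iff 1).mpr (summable_geometric_of_lt_one (norm_nonneg _)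
      hQ)).mul_right C).hasProdUniformlyOn_nat_one_add
      hcK (.of_forall fun n x hx ↦ ?_) (fun _ ↦ by fun_prop)
    rw [norm_neg, norm_mul, norm_pow]
    gcongr
    exact hC x hx
  have := H.hasProdLocallyUniformlyOn.differentiableOn
    (.of_forall fun _ ↦ by simpa [Finset.prod_fn] using
      DifferentiableOn.finsetProd (fun _ _ ↦ by fun_prop)) isOpen_univ
  exact differentiableOn_univ.mp this

/-- Real infinite product. -/
noncomputable def PP (Q : ℝ) : ℝ := (AP (Q : ℂ) 1).re

lemma pq_tendsto_c {Q : ℝ} (hQ0 : 0 < Q) (hQ : Q < 1) :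
    Filter.Tendsto (fun N => ((pq Q N : ℝ) : ℂ)) Filter.atTop (nhds (AP (Q : ℂ) 1)) := by
  have hn : ‖(Q : ℂ)‖ < 1 := by simpa [abs_of_pos hQ0] using hQ
  refine (AP_multipliable hn 1).hasProd.tendsto_prod_nat.congr ?_
  intro N
  unfold pq
  push_cast
  simp

lemma pq_tendsto {Q : ℝ} (hQ0 : 0 < Q) (hQ : Q < 1) :
    Filter.Tendsto (pq Q) Filter.atTop (nhds (PP Q)) :=
  (Complex.continuous_re.tendsto _).comp (pq_tendsto_c hQ0 hQ)

lemma PP_ofReal {Q : ℝ} (hQ0 : 0 < Q) (hQ : Q < 1) : (PP Q : ℂ) = AP (Q : ℂ) 1 :=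
  tendsto_nhds_unique ((Complex.continuous_ofReal.tendsto _).comp (pq_tendsto hQ0 hQ))
    (pq_tendsto_c hQ0 hQ)

lemma pq_pos {Q : ℝ} (hQ0 : 0 < Q) (hQ : Q < 1) (N : ℕ) : 0 < pq Q N := by
  unfold pq
  apply Finset.prod_pos
  intro k _
  have := pow_lt_one₀ hQ0.le hQ (Nat.succ_ne_zero k)
  simp only [Nat.succ_eq_add_one] at this
  linarith

lemma pq_anti {Q : ℝ} (hQ0 : 0 < Q) (hQ : Q < 1) : Antitone (pq Q) := by
  apply antitone_nat_of_succ_le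
  intro N
  rw [pq_succ]
  have := pq_pos hQ0 hQ N
  have h2 : 0 < Q ^ (N + 1) := by positivity
  nlinarith

lemma PP_pos {Q : ℝ} (hQ0 : 0 < Q) (hQ : Q < 1) : 0 < PP Q := by
  have hn : ‖(Q : ℂ)‖ < 1 := by simpa [abs_of_pos hQ0] using hQ
  have h1 : 0 ≤ PP Q := ge_of_tendsto' (pq_tendsto hQ0 hQ) (fun N => (pq_pos hQ0 hQ N).le)
  have h2 : PP Q ≠ 0 := by
    intro h
    have := PP_ofReal hQ0 hQ
    rw [h] at this
    exact AP_ne_zero hn (by simp) this.symm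
  exact lt_of_le_of_ne h1 (Ne.symm h2)

lemma PP_le {Q : ℝ} (hQ0 : 0 < Q) (hQ : Q < 1) (N : ℕ) : PP Q ≤ pq Q N :=
  (pq_anti hQ0 hQ).le_of_tendsto (pq_tendsto hQ0 hQ) N

lemma gb_eq {Q : ℝ} (hQ0 : 0 < Q) (hQ : Q < 1) (a b : ℕ) :
    gb Q (a + b) a = pq Q (a + b) / (pq Q a * pq Q b) := by
  have h1 := pq_pos hQ0 hQ a
  have h2 := pq_pos hQ0 hQ b
  rw [eq_div_iff (by positivity)]
  exact gb_closed Q (a + b) a b rfl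

lemma gb_bound {Q : ℝ} (hQ0 : 0 < Q) (hQ : Q < 1) (a b : ℕ) :
    |gb Q (a + b) a| ≤ 1 / PP Q := by
  rw [gb_eq hQ0 hQ]
  have h1 := pq_pos hQ0 hQ a
  have h2 := pq_pos hQ0 hQ b
  have h3 := pq_pos hQ0 hQ (a + b)
  have h4 := PP_pos hQ0 hQ
  have h5 := PP_le hQ0 hQ a
  have h6 := pq_anti hQ0 hQ (show b ≤ a + b by omega)
  rw [abs_of_pos (by positivity), div_le_div_iff₀ (by positivity) h4]
  nlinarith [mul_le_mul h6 h5 h4.le h2.le]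

/-- coefficients extended by zero -/
noncomputable def cN (Q : ℝ) (N : ℕ) (n : ℤ) : ℝ :=
  if n ∈ Finset.Icc (-(N : ℤ)) N then gb Q (2 * N) (n + N).toNat else 0

lemma cN_bound {Q : ℝ} (hQ0 : 0 < Q) (hQ : Q < 1) (N : ℕ) (n : ℤ) : |cN Q N n| ≤ 1 / PP Q := by
  unfold cN
  split_ifs with h
  · rw [Finset.mem_Icc] at h
    have : 2 * N = (n + N).toNat + (N - n).toNat := by omega
    rw [this]
    exact gb_bound hQ0 hQ _ _
  · have := PP_pos hQ0 hQ
    simp only [abs_zero]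
    positivity

lemma cN_tendsto {Q : ℝ} (hQ0 : 0 < Q) (hQ : Q < 1) (n : ℤ) :
    Filter.Tendsto (fun N => cN Q N n) Filter.atTop (nhds (1 / PP Q)) := by
  have hP := PP_pos hQ0 hQ
  have t1 : Filter.Tendsto (fun N : ℕ => (n + N).toNat) Filter.atTop Filter.atTop := by
    rw [Filter.tendsto_atTop]
    intro b
    filter_upwards [Filter.eventually_ge_atTop (b + n.natAbs)] with N hN
    omega
  have t2 : Filter.Tendsto (fun N : ℕ => (N - n).toNat) Filter.atTop Filter.atTop := by
    rw [Filter.tendsto_atTop]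
    intro b
    filter_upwards [Filter.eventually_ge_atTop (b + n.natAbs)] with N hN
    omega
  have t3 : Filter.Tendsto (fun N : ℕ => 2 * N) Filter.atTop Filter.atTop := by
    rw [Filter.tendsto_atTop]
    intro b
    filter_upwards [Filter.eventually_ge_atTop b] with N hN
    omega
  have hp := pq_tendsto hQ0 hQ
  have := (hp.comp t3).div ((hp.comp t1).mul (hp.comp t2)) (by positivity)
  have e : PP Q / (PP Q * PP Q) = 1 / PP Q := by field_simp
  rw [e] at this
  refine this.congr' ?_
  filter_upwards [Filter.eventually_ge_atTop n.natAbs] with N hN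
  unfold cN
  rw [if_pos (by rw [Finset.mem_Icc]; omega)]
  have h2 : 2 * N = (n + N).toNat + (N - n).toNat := by omega
  simp only [Function.comp, Pi.div_apply, Pi.mul_apply]
  rw [h2, gb_eq hQ0 hQ]

lemma LL_eq_tsum {q : ℝ} (hq : q ≠ 0) {w : ℂ} (hw : w ≠ 0) (N : ℕ) :
    LL q w N = ∑' n : ℤ, (cN (q ^ 2) N n : ℂ) * tt q w n := by
  rw [tsum_eq_sum (s := Finset.Icc (-(N : ℤ)) N), LL_eq_sum hq hw]
  · apply Finset.sum_nbij' (fun j : ℕ => (j : ℤ) - N) (fun n : ℤ => (n + N).toNat)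
    · intro j hj; simp only [Finset.mem_range, Finset.mem_Icc] at *; omega
    · intro j hj; simp only [Finset.mem_range, Finset.mem_Icc] at *; omega
    · intro j hj; simp
    · intro j hj; simp only [Finset.mem_Icc] at *; omega
    · intro j hj
      have : (j : ℤ) - N ∈ Finset.Icc (-(N : ℤ)) N := by
        simp only [Finset.mem_range, Finset.mem_Icc] at *; omega
      rw [cN, if_pos this]
      simp
  · intro n hn
    rw [cN, if_neg hn]
    simp

lemma triple_product {q : ℝ} (hq0 : 0 < q) (hq : q < 1) {w : ℂ} (hw : w ≠ 0)
    (hs : Summable (tt q w)) :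
    ∑' n, tt q w n = AP ((q : ℂ) ^ 2) 1 * (AP ((q : ℂ) ^ 2) w * ((1 - w⁻¹) * AP ((q : ℂ) ^ 2) w⁻¹)) := by
  have hQ0 : 0 < q ^ 2 := by positivity
  have hQ : q ^ 2 < 1 := pow_lt_one₀ hq0.le hq (by norm_num)
  have hn : ‖(q : ℂ) ^ 2‖ < 1 := by simpa using hQ
  have hP := PP_pos hQ0 hQ
  have h1 : Filter.Tendsto (fun N => LL q w N) Filter.atTop
      (nhds (∑' n : ℤ, ((1 / PP (q ^ 2) : ℝ) : ℂ) * tt q w n)) := by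
    simp_rw [LL_eq_tsum hq0.ne' hw]
    apply tendsto_tsum_of_dominated_convergence (bound := fun n => 1 / PP (q ^ 2) * ‖tt q w n‖)
    · exact hs.norm.mul_left _
    · intro n
      exact ((Complex.continuous_ofReal.tendsto _).comp (cN_tendsto hQ0 hQ n)).mul_const _
    · refine Filter.Eventually.of_forall fun N n => ?_
      rw [norm_mul, Complex.norm_real, Real.norm_eq_abs]
      gcongr
      exact cN_bound hQ0 hQ N n
  have h2 : Filter.Tendsto (fun N => LL q w N) Filter.atTop
      (nhds (AP ((q : ℂ) ^ 2) w * ((1 - w⁻¹) * AP ((q : ℂ) ^ 2) w⁻¹))) := by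
    unfold LL
    apply Filter.Tendsto.mul (AP_multipliable hn w).hasProd.tendsto_prod_nat
    rw [← Filter.tendsto_add_atTop_iff_nat 1]
    simp_rw [Finset.prod_range_succ', pow_zero, one_mul]
    rw [mul_comm]
    exact (AP_multipliable hn w⁻¹).hasProd.tendsto_prod_nat.mul_const _
  have h3 := tendsto_nhds_unique h1 h2
  rw [tsum_mul_left] at h3
  rw [← h3]
  have h4 := PP_ofReal hQ0 hQ
  rw [Complex.ofReal_pow] at h4
  rw [← h4, ← mul_assoc, ← Complex.ofReal_mul, mul_one_div_cancel hP.ne']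
  simp

lemma sTerm_eq_tt (r : ℝ) (z : ℂ) (n : ℤ) :
    sTerm 0 r z n = (cexp (-(r : ℂ) / 4) * cexp (I * z / 2)) *
      tt (Real.exp (-r)) (cexp (I * z)) n := by
  unfold sTerm tt
  have h1 : ((Real.exp (-r) : ℝ) : ℂ) ^ (n * (n + 1)) = cexp ((n * (n + 1) : ℂ) * (-(r : ℂ))) := by
    have := Complex.exp_int_mul (-(r : ℂ)) (n * (n + 1))
    push_cast at this ⊢
    rw [this]
  have h2 : cexp (I * z) ^ n = cexp ((n : ℂ) * (I * z)) := (Complex.exp_int_mul _ _).symm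
  rw [h1, h2, pow_zero, mul_one]
  rw [show ∀ a b c d e : ℂ, (a * b) * (c * d * e) = c * (a * b * d * e) by intros; ring]
  rw [← Complex.exp_add, ← Complex.exp_add, ← Complex.exp_add]
  congr 2
  unfold hfreq
  push_cast
  ring

lemma qexp_norm {r : ℝ} (hr : 0 < r) : ‖((Real.exp (-r) : ℝ) : ℂ) ^ 2‖ < 1 := by
  rw [norm_pow, Complex.norm_real, Real.norm_eq_abs, abs_of_pos (Real.exp_pos _)]
  have : Real.exp (-r) < 1 := by rw [← Real.exp_zero]; exact Real.exp_lt_exp.2 (by linarith)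
  exact pow_lt_one₀ (Real.exp_pos _).le this two_ne_zero

lemma SS_product {r : ℝ} (hr : 0 < r) (z : ℂ) :
    SS 0 r z = (1 / I) * ((cexp (-(r : ℂ) / 4) * cexp (I * z / 2)) *
      (AP (((Real.exp (-r) : ℝ) : ℂ) ^ 2) 1 * (AP (((Real.exp (-r) : ℝ) : ℂ) ^ 2) (cexp (I * z)) *
        ((1 - (cexp (I * z))⁻¹) * AP (((Real.exp (-r) : ℝ) : ℂ) ^ 2) (cexp (I * z))⁻¹)))) := by
  have hc : cexp (-(r : ℂ) / 4) * cexp (I * z / 2) ≠ 0 :=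
    mul_ne_zero (Complex.exp_ne_zero _) (Complex.exp_ne_zero _)
  have hs : Summable (tt (Real.exp (-r)) (cexp (I * z))) := by
    have h := sTerm_summable 0 hr z
    have e : sTerm 0 r z = fun n => (cexp (-(r : ℂ) / 4) * cexp (I * z / 2)) *
      tt (Real.exp (-r)) (cexp (I * z)) n := funext (sTerm_eq_tt r z)
    rw [e] at h
    exact (summable_mul_left_iff hc).1 h
  rw [← triple_product (Real.exp_pos _) (by rw [← Real.exp_zero]; exact Real.exp_lt_exp.2 (by linarith)) (Complex.exp_ne_zero _) hs,
    ← tsum_mul_left]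
  unfold SS
  congr 1
  exact tsum_congr (sTerm_eq_tt r z)

lemma ss_zero_ne {r : ℝ} (hr : 0 < r) {x : ℝ} (hx : x ∈ Set.Ioo 0 (2 * Real.pi)) :
    ss 0 r x ≠ 0 := by
  have hn : ‖cexp (I * x)‖ = 1 := by
    rw [mul_comm]; exact Complex.norm_exp_ofReal_mul_I x
  have h : SS 0 r x ≠ 0 := by
    rw [SS_product hr]
    refine mul_ne_zero (by simp) (mul_ne_zero (mul_ne_zero (Complex.exp_ne_zero _)
      (Complex.exp_ne_zero _)) (mul_ne_zero (AP_ne_zero (qexp_norm hr) (by simp))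
      (mul_ne_zero (AP_ne_zero (qexp_norm hr) hn.le) (mul_ne_zero ?_
      (AP_ne_zero (qexp_norm hr) (by rw [norm_inv, hn]; simp))))))
    intro h0
    have h1 : cexp (I * x) = 1 := by
      have := (sub_eq_zero.1 h0).symm
      exact inv_eq_one.1 this
    obtain ⟨n, hn⟩ := Complex.exp_eq_one_iff.1 h1
    have h2 : (x : ℂ) = ((n * (2 * Real.pi) : ℝ) : ℂ) := by
      apply mul_left_cancel₀ I_ne_zero
      rw [hn]; push_cast; ring
    have h3 : x = n * (2 * Real.pi) := Complex.ofReal_injective h2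
    have hp : 0 < 2 * Real.pi := Real.two_pi_pos
    have h4 : (0 : ℝ) < n := by
      by_contra hc
      have := mul_nonpos_of_nonpos_of_nonneg (not_lt.1 hc) hp.le
      linarith [hx.1]
    have h5 : (n : ℝ) < 1 := by
      by_contra hc
      have := mul_le_mul_of_nonneg_right (not_lt.1 hc) hp.le
      linarith [hx.2]
    have h6 : 0 < n := by exact_mod_cast h4
    have h7 : n < 1 := by exact_mod_cast h5
    omega
  intro h0
  rw [← ss_ofReal, h0] at h
  simp at h

lemma SS_one_zero {r : ℝ} (hr : 0 < r) :
    SS 1 r 0 = cexp (-(r : ℂ) / 4) * (AP (((Real.exp (-r) : ℝ) : ℂ) ^ 2) 1) ^ 3 := by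
  set Q : ℂ := ((Real.exp (-r) : ℝ) : ℂ) ^ 2 with hQ
  have hd := AP_differentiable (qexp_norm hr)
  rw [← hQ] at hd
  let G : ℂ → ℂ := fun z => (1 / I) * ((cexp (-(r : ℂ) / 4) * cexp (I * z / 2)) *
      (AP Q 1 * (AP Q (cexp (I * z)) * AP Q (cexp (-(I * z))))))
  let F : ℂ → ℂ := fun z => 1 - cexp (-(I * z))
  have hG : Differentiable ℂ G := by
    have h1 : Differentiable ℂ (fun z => AP Q (cexp (I * z))) := hd.comp (by fun_prop)
    have h2 : Differentiable ℂ (fun z => AP Q (cexp (-(I * z)))) := hd.comp (by fun_prop)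
    fun_prop
  have hF : HasDerivAt F I 0 := by
    have h := (((hasDerivAt_id (0 : ℂ)).const_mul I).neg.cexp).const_sub 1
    simpa [F] using h
  have hGF := (hG 0).hasDerivAt.mul hF
  have hE : SS 0 r = G * F := by
    funext z
    rw [SS_product hr, ← Complex.exp_neg]
    simp only [G, F, Pi.mul_apply]
    ring
  have hS := SS_hasDerivAt_z 0 hr 0
  rw [hE] at hS
  have := hS.unique hGF
  rw [zero_add] at this
  rw [this]
  simp only [G, F]
  simp
  field_simp
  rw [Complex.I_sq]; ring

lemma SS_one_zero_eta {r : ℝ} (hr : 0 < r) :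
    SS 1 r 0 = ModularForm.eta (I / (Real.pi : ℂ) * (r : ℂ)) ^ 3 := by
  rw [SS_one_zero hr]
  unfold ModularForm.eta AP
  rw [mul_pow]
  have hp : (Real.pi : ℂ) ≠ 0 := by exact_mod_cast Real.pi_ne_zero
  congr 1
  · rw [Function.Periodic.qParam, ← Complex.exp_nat_mul]
    congr 1
    push_cast
    field_simp
    rw [Complex.I_sq]; ring
  · congr 2
    funext n
    rw [ModularForm.eta_q_eq_pow, mul_one]
    congr 2
    push_cast
    rw [← Complex.exp_nat_mul]
    congr 1
    push_cast
    field_simp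
    rw [Complex.I_sq]; ring

lemma SS_three_zero {r : ℝ} (hr : 0 < r) :
    SS 3 r 0 = -3 * (wzeta r (Real.pi : ℂ) / Real.pi) * SS 1 r 0 := by
  have hp : (Real.pi : ℂ) ≠ 0 := by exact_mod_cast Real.pi_ne_zero
  have hτ : (tauR r hr : ℂ) = I / (Real.pi : ℂ) * (r : ℂ) := by
    rw [tauR_coe]; push_cast; ring
  have hmem : I / (Real.pi : ℂ) * (r : ℂ) ∈ UpperHalfPlane.upperHalfPlaneSet := by
    rw [← hτ]; exact (tauR r hr).2
  have hdiff := ModularForm.differentiableAt_eta_of_mem_upperHalfPlaneSet hmem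
  have hne := ModularForm.eta_ne_zero hmem
  have hlog := ModularForm.logDeriv_eta_eq_E2 (tauR r hr)
  rw [hτ, logDeriv_apply, div_eq_iff hne] at hlog
  have h1 : HasDerivAt (fun s : ℝ => I / (Real.pi : ℂ) * (s : ℂ)) (I / (Real.pi : ℂ)) r := by
    simpa using (Complex.ofRealCLM.hasDerivAt (x := r)).const_mul (I / (Real.pi : ℂ))
  have h2 : HasDerivAt (fun s : ℝ => ModularForm.eta (I / (Real.pi : ℂ) * (s : ℂ)))
      (deriv ModularForm.eta (I / (Real.pi : ℂ) * (r : ℂ)) * (I / (Real.pi : ℂ))) r :=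
    hdiff.hasDerivAt.comp_of_eq r h1 rfl
  have h3 := h2.pow 3
  have h4 := SS_hasDerivAt_r 1 hr 0
  have he : (fun s : ℝ => SS 1 s 0) =ᶠ[nhds r]
      ((fun s : ℝ => ModularForm.eta (I / (Real.pi : ℂ) * (s : ℂ))) ^ 3) := by
    filter_upwards [lt_mem_nhds hr] with s hs
    rw [SS_one_zero_eta hs]; rfl
  have h5 := h4.unique (h3.congr_of_eventuallyEq he)
  rw [show (1 + 2 : ℕ) = 3 from rfl] at h5
  rw [h5, SS_one_zero_eta hr, hlog, wzeta_pi r hr]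
  push_cast
  field_simp
  rw [Complex.I_sq]
  ring

lemma ss_three_zero {r : ℝ} (hr : 0 < r) :
    ss 3 r 0 = -3 * ((wzeta r (Real.pi : ℂ)).re / Real.pi) * ss 1 r 0 := by
  have h := SS_three_zero hr
  have e3 := ss_ofReal 3 r 0
  have e1 := ss_ofReal 1 r 0
  rw [Complex.ofReal_zero] at e3 e1
  rw [← e3, ← e1] at h
  have h' := congrArg Complex.re h
  rw [Complex.ofReal_re, Complex.re_mul_ofReal] at h'
  rw [h', show (-3 : ℂ) * (wzeta r (Real.pi : ℂ) / Real.pi)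
    = ((-3 : ℝ) : ℂ) * (wzeta r (Real.pi : ℂ) / ((Real.pi : ℝ) : ℂ)) by push_cast; rfl,
    Complex.re_ofReal_mul, Complex.div_ofReal_re]

lemma deriv_Theta_zero_re {r : ℝ} (hr : 0 < r) : (deriv (Theta r) 0).re = ss 1 r 0 := by
  rw [deriv_Theta hr]; unfold ss; rw [Complex.ofReal_zero]

lemma Hker_re {r : ℝ} (hr : 0 < r) (x : ℝ) :
    (Hker r (x : ℂ)).re = 2 * ss 1 r x / ss 0 r x := by
  unfold Hker
  rw [deriv_Theta hr, Theta_eq_SS, ← ss_ofReal, ← ss_ofReal]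
  rw [show (2 : ℂ) * (ss 1 r x : ℂ) / (ss 0 r x : ℂ) = ((2 * ss 1 r x / ss 0 r x : ℝ) : ℂ) by
    push_cast; rfl, Complex.ofReal_re]

lemma Ztwo_eq {r : ℝ} (hr : 0 < r) (x : ℝ) :
    Ztwo r x = ss 1 r 0 * (2 * ss 1 r x / ss 0 r x) / ss 0 r x := by
  unfold Ztwo
  rw [deriv_Theta_zero_re hr, Hker_re hr, Theta_eq_SS]
  rfl

lemma deriv_Hker_re {r : ℝ} (hr : 0 < r) {x : ℝ} (h0 : ss 0 r x ≠ 0) :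
    (deriv (Hker r) (x : ℂ)).re =
      2 * (ss 2 r x * ss 0 r x - ss 1 r x * ss 1 r x) / ss 0 r x ^ 2 := by
  have hS0 : SS 0 r x ≠ 0 := by
    rw [← ss_ofReal]; exact_mod_cast h0
  have e : Hker r = fun z => 2 * SS 1 r z / SS 0 r z := by
    funext z
    unfold Hker
    rw [deriv_Theta hr, Theta_eq_SS]
  have h := (((SS_hasDerivAt_z 1 hr x).const_mul 2).div (SS_hasDerivAt_z 0 hr x) hS0).deriv
  rw [e]
  have h' : deriv (fun z => 2 * SS 1 r z / SS 0 r z) (x : ℂ) =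
    ((2 * (ss 2 r x * ss 0 r x - ss 1 r x * ss 1 r x) / ss 0 r x ^ 2 : ℝ) : ℂ) := by
    refine Eq.trans h ?_
    push_cast
    rw [ss_ofReal, ss_ofReal, ss_ofReal]
    ring
  rw [h', Complex.ofReal_re]

/-- Null-vector equation for the explicit partition function at κ = 2. -/
theorem null_vector_kappa_two (r : ℝ) (hr : 0 < r)
    (x : ℝ) (hx : x ∈ Set.Ioo 0 (2 * Real.pi)) :
    deriv (fun s => Ztwo s x) r =
      deriv (fun y => deriv (Ztwo r) y) x +
      (Hker r (x : ℂ)).re * deriv (Ztwo r) x +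
      (deriv (Hker r) (x : ℂ)).re * Ztwo r x -
      3 * ((wzeta r (Real.pi : ℂ)).re / Real.pi) * Ztwo r x := by
  have h0 := ss_zero_ne hr hx
  -- first derivative in x
  have hD1 : ∀ y ∈ Set.Ioo 0 (2 * Real.pi), deriv (Ztwo r) y =
      2 * ss 1 r 0 * (ss 2 r y * ss 0 r y - 2 * ss 1 r y ^ 2) / ss 0 r y ^ 3 := by
    intro y hy
    have hy0 := ss_zero_ne hr hy
    have e : Ztwo r = fun y => ss 1 r 0 * (2 * ss 1 r y / ss 0 r y) / ss 0 r y :=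
      funext (Ztwo_eq hr)
    rw [e]
    have h := ((((ss_hasDerivAt_x 1 hr y).const_mul 2).div (ss_hasDerivAt_x 0 hr y)
      hy0).const_mul (ss 1 r 0)).div (ss_hasDerivAt_x 0 hr y) hy0
    refine Eq.trans h.deriv ?_
    simp only [Pi.div_apply, zero_add, show (1 + 1 : ℕ) = 2 from rfl]
    field_simp
    ring
  have hD2 : deriv (fun y => deriv (Ztwo r) y) x =
      2 * ss 1 r 0 * ((ss 3 r x * ss 0 r x - 3 * ss 1 r x * ss 2 r x) * ss 0 r x
        - 3 * (ss 2 r x * ss 0 r x - 2 * ss 1 r x ^ 2) * ss 1 r x) / ss 0 r x ^ 4 := by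
    have e : (fun y => deriv (Ztwo r) y) =ᶠ[nhds x] fun y =>
        2 * ss 1 r 0 * (ss 2 r y * ss 0 r y - 2 * ss 1 r y ^ 2) / ss 0 r y ^ 3 := by
      filter_upwards [isOpen_Ioo.mem_nhds hx] with y hy using hD1 y hy
    rw [e.deriv_eq]
    have h := (((((ss_hasDerivAt_x 2 hr x).mul (ss_hasDerivAt_x 0 hr x)).sub
      (((ss_hasDerivAt_x 1 hr x).pow 2).const_mul 2)).const_mul (2 * ss 1 r 0)).div
      ((ss_hasDerivAt_x 0 hr x).pow 3) (pow_ne_zero 3 h0))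
    refine Eq.trans h.deriv ?_
    simp only [Pi.div_apply, Pi.mul_apply, Pi.sub_apply, Pi.pow_apply, zero_add,
      show (1 + 1 : ℕ) = 2 from rfl, show (2 + 1 : ℕ) = 3 from rfl]
    push_cast
    field_simp
    ring
  have hDr : deriv (fun s => Ztwo s x) r =
      2 * (ss 3 r 0 * ss 1 r x * ss 0 r x + ss 1 r 0 * ss 3 r x * ss 0 r x
        - 2 * ss 1 r 0 * ss 1 r x * ss 2 r x) / ss 0 r x ^ 3 := by
    have e : (fun s => Ztwo s x) =ᶠ[nhds r] fun s =>
        ss 1 s 0 * (2 * ss 1 s x / ss 0 s x) / ss 0 s x := by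
      filter_upwards [lt_mem_nhds hr] with s hs using Ztwo_eq hs x
    rw [e.deriv_eq]
    have h := ((ss_hasDerivAt_r 1 hr 0).mul (((ss_hasDerivAt_r 1 hr x).const_mul 2).div
      (ss_hasDerivAt_r 0 hr x) h0)).div (ss_hasDerivAt_r 0 hr x) h0
    refine Eq.trans h.deriv ?_
    simp only [Pi.div_apply, Pi.mul_apply, zero_add, show (1 + 2 : ℕ) = 3 from rfl]
    field_simp
    ring
  rw [hDr, hD2, hD1 x hx, Hker_re hr, deriv_Hker_re hr h0, Ztwo_eq hr, ss_three_zero hr]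
  generalize (wzeta r (Real.pi : ℂ)).re / Real.pi = ζ
  field_simp
  ring
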